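/- Let ε ∈ [0,1), let N_AD be the qubit amplitude damping channel with Kraus operators A₀ = |0⟩⟨0| + √(1−ε)·|1⟩⟨1| and A₁ = √ε·|0⟩⟨1|, and let H be the swap operator on ℂ²⊗ℂ². Suppose f > 0 and t ∈ ℝ are real numbers and C is a quantum channel on 4×4 complex matrices (with Kraus operators Kⱼ, Σⱼ Kⱼ†Kⱼ = I₄) such that (N_AD ⊗ N_AD)†(C†(H)) = (1/f)·(H + t·I₄), where C†(Y) = Σⱼ Kⱼ†YKⱼ and (N_AD ⊗ N_AD)†(Y) = Σ_{i,j∈{0,1}} (Aᵢ⊗Aⱼ)† Y (Aᵢ⊗Aⱼ). Then f ≥ 1/(1−ε)². (Optimality of the sampling overhead 1/(1−ε)² for retrieving the second moment under amplitude damping noise.) -/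

import Mathlib

open Matrix BigOperators Kronecker

/-- Amplitude damping Kraus operator `A₀ = |0⟩⟨0| + √(1−ε)|1⟩⟨1|`. -/
noncomputable def A0 (ε : ℝ) : Matrix (Fin 2) (Fin 2) ℂ :=
  !![1, 0; 0, (Real.sqrt (1 - ε) : ℂ)]

/-- Amplitude damping Kraus operator `A₁ = √ε·|0⟩⟨1|`. -/
noncomputable def A1 (ε : ℝ) : Matrix (Fin 2) (Fin 2) ℂ :=
  !![0, (Real.sqrt ε : ℂ); 0, 0]

/-- The family of amplitude damping Kraus operators. -/
noncomputable def AD (ε : ℝ) : Fin 2 → Matrix (Fin 2) (Fin 2) ℂ := ![A0 ε, A1 ε]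

/-- The swap operator on `ℂ² ⊗ ℂ²`, `H(u⊗v) = v⊗u`. -/
noncomputable def Hswap : Matrix (Fin 2 × Fin 2) (Fin 2 × Fin 2) ℂ :=
  Matrix.of fun p q => if p.1 = q.2 ∧ p.2 = q.1 then 1 else 0

open scoped ComplexOrder in
theorem hswap_psd_aux (c : ℂ) (hc : c = 1 ∨ c = -1) : (1 + c • Hswap).PosSemidef := by
  have hH : Hswapᴴ = Hswap := by
    ext ⟨i, j⟩ ⟨k, l⟩
    fin_cases i <;> fin_cases j <;> fin_cases k <;> fin_cases l <;> simp [Hswap]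
  have hHH : Hswap * Hswap = 1 := by
    ext ⟨i, j⟩ ⟨k, l⟩
    fin_cases i <;> fin_cases j <;> fin_cases k <;> fin_cases l <;>
      simp [Hswap, Matrix.mul_apply, Fintype.sum_prod_type]
  have h := Matrix.posSemidef_conjTranspose_mul_self (1 + c • Hswap)
  have e : (1 + c • Hswap)ᴴ * (1 + c • Hswap) = (2 : ℝ) • (1 + c • Hswap) := by
    have hs : star c = c := by rcases hc with rfl | rfl <;> simp
    have hcc : c * c = 1 := by rcases hc with rfl | rfl <;> simp
    rw [Matrix.conjTranspose_add, Matrix.conjTranspose_smul, hs, hH, Matrix.conjTranspose_one]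
    simp only [add_mul, mul_add, one_mul, mul_one, Matrix.smul_mul, Matrix.mul_smul, hHH,
      smul_smul, hcc, one_smul, two_smul]
    abel
  rw [e] at h
  have h2 := h.smul (show (0 : ℝ) ≤ 1 / 2 by norm_num)
  rw [smul_smul] at h2
  norm_num at h2
  exact h2

open scoped ComplexOrder in
theorem channel_psd_aux (m : ℕ) (K : Fin m → Matrix (Fin 2 × Fin 2) (Fin 2 × Fin 2) ℂ)
    (hTP : ∑ j, (K j)ᴴ * K j = 1) (c : ℂ) (hc : c = 1 ∨ c = -1) :
    (1 + c • ∑ l, (K l)ᴴ * Hswap * K l).PosSemidef := by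
  have e : 1 + c • ∑ l, (K l)ᴴ * Hswap * K l = ∑ l, (K l)ᴴ * (1 + c • Hswap) * K l := by
    have h : ∑ l, (K l)ᴴ * (1 + c • Hswap) * K l
        = ∑ l, ((K l)ᴴ * K l + c • ((K l)ᴴ * Hswap * K l)) :=
      Finset.sum_congr rfl fun l _ => by simp [mul_add, add_mul]
    rw [h, Finset.sum_add_distrib, hTP, Finset.smul_sum]
  rw [e]
  exact Matrix.posSemidef_sum _ fun l _ => (hswap_psd_aux c hc).conjTranspose_mul_mul_same (K l)

/-- optimality for amplitude damping noise: if `f > 0`, `t ∈ ℝ` and a quantum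
channel `C` with Kraus operators `K j` (`Σⱼ Kⱼ†Kⱼ = I₄`) satisfy
`(N_AD ⊗ N_AD)†(C†(H)) = (1/f)·(H + t·I₄)`, where
`(N_AD⊗N_AD)†(Y) = Σ_{i,j} (Aᵢ⊗Aⱼ)† Y (Aᵢ⊗Aⱼ)` and `C†(Y) = Σⱼ Kⱼ†YKⱼ`, then
`f ≥ 1/(1−ε)²`. -/
theorem amplitudeDamping_overhead_optimal (ε : ℝ) (hε : 0 ≤ ε) (hε1 : ε < 1)
    (f t : ℝ) (hf : 0 < f)
    (m : ℕ) (K : Fin m → Matrix (Fin 2 × Fin 2) (Fin 2 × Fin 2) ℂ)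
    (hTP : ∑ j, (K j)ᴴ * K j = 1)
    (hcond : ∑ i : Fin 2, ∑ j : Fin 2,
        (AD ε i ⊗ₖ AD ε j)ᴴ * (∑ l, (K l)ᴴ * Hswap * K l) * (AD ε i ⊗ₖ AD ε j)
      = ((f⁻¹ : ℝ) : ℂ) • (Hswap + (t : ℂ) • (1 : Matrix (Fin 2 × Fin 2) (Fin 2 × Fin 2) ℂ))) :
    1 / (1 - ε) ^ 2 ≤ f := by
  have hp := channel_psd_aux m K hTP 1 (Or.inl rfl)
  have hn := channel_psd_aux m K hTP (-1) (Or.inr rfl)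
  generalize (∑ l, (K l)ᴴ * Hswap * K l) = Y at hp hn hcond
  have a1 := hn.re_dotProduct_nonneg (Pi.single (1, 1) 1)
  have a2 := hp.re_dotProduct_nonneg (Pi.single (0, 1) 1 - Pi.single (1, 0) 1)
  simp [dotProduct, Matrix.mulVec, Fintype.sum_prod_type, Pi.single_apply, Matrix.one_apply] at a1 a2
  have key := fun p q => congrArg Complex.re (congrFun (congrFun hcond p) q)
  have h00 := key (0, 0) (0, 0)
  have h01 := key (0, 1) (0, 1)
  have h10 := key (1, 0) (1, 0)
  have h11 := key (1, 1) (1, 1)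
  have ha := key (0, 1) (1, 0)
  have hb := key (1, 0) (0, 1)
  clear key hcond
  simp [AD, A0, A1, Hswap, Matrix.mul_apply, Fintype.sum_prod_type, Fin.sum_univ_two] at h00 h01 h10 h11 ha hb
  have e1 : √(1 - ε) * √(1 - ε) = 1 - ε := Real.mul_self_sqrt (by linarith)
  have e2 : √ε * √ε = ε := Real.mul_self_sqrt hε
  generalize √(1 - ε) = r at *
  generalize √ε = w at *
  generalize (Y (0, 0) (0, 0)).re = y00 at *
  generalize (Y (0, 1) (0, 1)).re = y01 at *
  generalize (Y (1, 0) (1, 0)).re = y10 at *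
  generalize (Y (1, 1) (1, 1)).re = y11 at *
  generalize (Y (0, 1) (1, 0)).re = a at *
  generalize (Y (1, 0) (0, 1)).re = b at *
  have g01 : (1 - ε) * y01 + ε * y00 = f⁻¹ * t := by
    rw [← h01]; linear_combination -y01 * e1 - y00 * e2
  have g10 : (1 - ε) * y10 + ε * y00 = f⁻¹ * t := by
    rw [← h10]; linear_combination -y10 * e1 - y00 * e2
  have ga : (1 - ε) * a = f⁻¹ := by rw [← ha]; linear_combination -a * e1
  have gb : (1 - ε) * b = f⁻¹ := by rw [← hb]; linear_combination -b * e1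
  have g11 : (1 - ε) ^ 2 * y11 + (1 - ε) * ε * (y10 + y01) + ε ^ 2 * y00 = f⁻¹ * (1 + t) := by
    rw [← h11, ← e1]
    rw [show r * r * y11 * (r * r) + r * w * y10 * (r * w) +
      (w * r * y01 * (w * r) + w * w * y00 * (w * w)) = (r * r) * (r * r) * y11
        + (r * r) * (w * w) * (y10 + y01) + (w * w) * (w * w) * y00 by ring, e2]
    ring
  have hs : 0 < 1 - ε := by linarith
  have hmain : (1 - ε) ^ 2 * (y11 - (y01 + y10 - a - b) / 2) = 2 * f⁻¹ := by
    linear_combination g11 - (ε + (1 - ε) / 2) * (g01 + g10) + (1 - ε) / 2 * (ga + gb) + ε * h00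
  have hle : y11 - (y01 + y10 - a - b) / 2 ≤ 2 := by linarith
  have hsq : 0 < (1 - ε) ^ 2 := by positivity
  have hfin : f⁻¹ ≤ (1 - ε) ^ 2 := by nlinarith
  rw [one_div]
  exact inv_le_of_inv_le₀ hf hfin
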